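/- arXiv:2210.15175 — 2 statements merged into one kernel-verified Lean document; each statement's English description precedes it below -/
import Mathlib

section
/- There is a universal constant c > 0 such that the following holds. Let X be a finite partially ordered set with |X| ≥ 2, let ℓ be an R-distance-based loss function, let n ≥ 1, ε ∈ (0,1] and 0 ≤ δ < 0.01·ε/|X|. Then for every (ε,δ)-differentially private randomized algorithm M mapping datasets D ∈ (X×[0,1])^n to probability distributions over monotone functions f : X → [0,1], there exists a dataset D such that the expected excess empirical risk E_{f∼M(D)}[L_ℓ(f;D)] − min_{g monotone} L_ℓ(g;D) is at least c · R · min{1, (width(X) + log|X|)/(εn)}. -/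
open MeasureTheory

noncomputable section

/-- The (normalized) empirical risk of `f` on dataset `D` with loss `ℓ`. -/
def empRisk {X : Type*} (ℓ : ℝ → ℝ → ℝ) {n : ℕ} (f : X → ℝ) (D : Fin n → X × ℝ) : ℝ :=
  (1 / (n : ℝ)) * ∑ i, ℓ (f (D i).1) (D i).2

/-- A valid dataset: all labels lie in `[0,1]`. -/
def IsDataset {X : Type*} {n : ℕ} (D : Fin n → X × ℝ) : Prop :=
  ∀ i, (D i).2 ∈ Set.Icc (0 : ℝ) 1

/-- Two (valid) datasets are neighboring if they differ in at most one entry. -/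
def NeighborDS {X : Type*} {n : ℕ} (D D' : Fin n → X × ℝ) : Prop :=
  IsDataset D ∧ IsDataset D' ∧ ∃ i, ∀ j, j ≠ i → D j = D' j

/-- A monotone function on the poset `X` taking values in `[0,1]`. -/
def IsMonotone01 {X : Type*} [PartialOrder X] (f : X → ℝ) : Prop :=
  Monotone f ∧ ∀ x, f x ∈ Set.Icc (0 : ℝ) 1

/-- The optimal empirical risk over all monotone `[0,1]`-valued functions. -/
def optRisk {X : Type*} [PartialOrder X] (ℓ : ℝ → ℝ → ℝ) {n : ℕ} (D : Fin n → X × ℝ) : ℝ :=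
  ⨅ g : {g : X → ℝ // IsMonotone01 g}, empRisk ℓ g.1 D

/-- `(ε, δ)`-differential privacy of a mechanism `M` w.r.t. a neighboring relation. -/
def IsDP {I Ω : Type*} [MeasurableSpace Ω] (Neighbor : I → I → Prop)
    (M : I → Measure Ω) (ε δ : ℝ) : Prop :=
  ∀ D D', Neighbor D D' → ∀ S : Set Ω, MeasurableSet S →
    M D S ≤ ENNReal.ofReal (Real.exp ε) * M D' S + ENNReal.ofReal δ

/-- A loss function `ℓ : [0,1] × [0,1] → ℝ≥0` that is `L`-Lipschitz in its first argument. -/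
def IsLipschitzLoss (ℓ : ℝ → ℝ → ℝ) (L : ℝ) : Prop :=
  (∀ y z : ℝ, y ∈ Set.Icc (0:ℝ) 1 → z ∈ Set.Icc (0:ℝ) 1 → 0 ≤ ℓ y z) ∧
  (∀ y y' z : ℝ, y ∈ Set.Icc (0:ℝ) 1 → y' ∈ Set.Icc (0:ℝ) 1 → z ∈ Set.Icc (0:ℝ) 1 →
    |ℓ y z - ℓ y' z| ≤ L * |y - y'|)

/-- An `R`-distance-based loss function: `ℓ(y,y') = g(|y - y'|)` for a non-decreasing
nonnegative `g` with `g 0 = 0` and `g (1/2) ≥ R`. -/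
def IsDistanceBasedLoss (ℓ : ℝ → ℝ → ℝ) (R : ℝ) : Prop :=
  ∃ g : ℝ → ℝ, MonotoneOn g (Set.Icc (0:ℝ) 1) ∧ (∀ t ∈ Set.Icc (0:ℝ) 1, 0 ≤ g t) ∧
    g 0 = 0 ∧ R ≤ g (1 / 2) ∧
    ∀ y y' : ℝ, y ∈ Set.Icc (0:ℝ) 1 → y' ∈ Set.Icc (0:ℝ) 1 → ℓ y y' = g |y - y'|

/-- The width of a poset: the largest size of an antichain. -/
def posetWidth (X : Type*) [PartialOrder X] : ℕ :=
  sSup {k | ∃ A : Finset X, IsAntichain (· ≤ ·) (A : Set X) ∧ A.card = k}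

/-- An isotonic-regression mechanism: on each valid dataset it outputs a probability
distribution supported on monotone `[0,1]`-valued functions. -/
def IsIsoRegAlg {X : Type*} [PartialOrder X] {n : ℕ}
    (M : (Fin n → X × ℝ) → Measure (X → ℝ)) : Prop :=
  ∀ D : Fin n → X × ℝ, IsDataset D →
    IsProbabilityMeasure (M D) ∧ M D {f | IsMonotone01 f} = 1


/-- The dataset containing `k` copies of each labelled point `lab j`, placed according to the
embedding `e`, and padded with copies of `z`. -/
def blockData {X J : Type*} {n k : ℕ} (e : J × Fin k ↪ Fin n) (lab : J → X × ℝ) (z : X × ℝ) :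
    Fin n → X × ℝ :=
  Function.extend e (fun p => lab p.1) (fun _ => z)

lemma blockData_apply {X J : Type*} {n k : ℕ} (e : J × Fin k ↪ Fin n) (lab : J → X × ℝ)
    (z : X × ℝ) (p : J × Fin k) : blockData e lab z (e p) = lab p.1 :=
  e.injective.extend_apply _ _ p

lemma blockData_induction {X J : Type*} {n k : ℕ} (e : J × Fin k ↪ Fin n) {lab : J → X × ℝ}
    {z : X × ℝ} {P : X × ℝ → Prop} (hlab : ∀ j, P (lab j)) (hz : P z) (i : Fin n) :
    P (blockData e lab z i) := by
  by_cases h : ∃ p, e p = i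
  · obtain ⟨p, rfl⟩ := h
    rw [blockData_apply]
    exact hlab _
  · rw [blockData, Function.extend_apply' _ _ _ h]
    exact hz

/-- Two block datasets agree outside the blocks on which their labels differ. -/
lemma blockData_eq_of_notMem {X J : Type*} {n k : ℕ} (e : J × Fin k ↪ Fin n)
    {lab lab' : J → X × ℝ} (z : X × ℝ) {T : Finset J} (h : ∀ j, j ∉ T → lab j = lab' j)
    (i : Fin n) (hi : i ∉ (T ×ˢ Finset.univ).map e) :
    blockData e lab z i = blockData e lab' z i := by
  by_cases hp : ∃ p, e p = i
  · obtain ⟨p, rfl⟩ := hp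
    rw [blockData_apply, blockData_apply]
    refine h _ fun hT => hi ?_
    exact Finset.mem_map_of_mem e (by simp [hT])
  · rw [blockData, blockData, Function.extend_apply' _ _ _ hp, Function.extend_apply' _ _ _ hp]

/-- Group privacy. -/
lemma IsDP.group_privacy {X : Type*} [PartialOrder X] {n : ℕ}
    {M : (Fin n → X × ℝ) → Measure (X → ℝ)} {ε δ : ℝ} (hε : 0 < ε) (hδ : 0 ≤ δ)
    (hM : IsIsoRegAlg M) (hDP : IsDP NeighborDS M ε δ) {S : Set (X → ℝ)} (hS : MeasurableSet S)
    {D' : Fin n → X × ℝ} (hD' : IsDataset D') (s : Finset (Fin n)) :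
    ∀ D : Fin n → X × ℝ, IsDataset D → (∀ i, i ∉ s → D i = D' i) →
      (M D).real S ≤
        Real.exp (s.card * ε) * (M D').real S + δ / ε * (Real.exp (s.card * ε) - 1) := by
  classical
  induction s using Finset.induction_on with
  | empty =>
    intro D _ h
    obtain rfl : D = D' := funext fun i => h i (by simp)
    simp
  | insert i s his ih =>
    intro D hD h
    set D₁ := Function.update D i (D' i) with hD₁
    have hD₁v : IsDataset D₁ := by
      intro j
      by_cases hj : j = i
      · subst hj
        simpa [hD₁] using hD' j
      · simpa [hD₁, hj] using hD j
    have hagree : ∀ j, j ∉ s → D₁ j = D' j := by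
      intro j hj
      by_cases hji : j = i
      · subst hji
        simp [hD₁]
      · simpa [hD₁, hji] using h j (by simp [hji, hj])
    have hnb : NeighborDS D D₁ :=
      ⟨hD, hD₁v, i, fun j hj => by simp [hD₁, hj]⟩
    have := (hM D hD).1
    have := (hM D₁ hD₁v).1
    have hstep : (M D).real S ≤ Real.exp ε * (M D₁).real S + δ := by
      have h1 := ENNReal.toReal_mono (by finiteness) (hDP D D₁ hnb S hS)
      rwa [ENNReal.toReal_add (by finiteness) (by finiteness), ENNReal.toReal_mul,
        ENNReal.toReal_ofReal (Real.exp_pos _).le, ENNReal.toReal_ofReal hδ] at h1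
    have h2 := ih D₁ hD₁v hagree
    have hexp : Real.exp ((insert i s).card * ε) = Real.exp ε * Real.exp (s.card * ε) := by
      rw [Finset.card_insert_of_notMem his, ← Real.exp_add]
      push_cast
      ring_nf
    rw [hexp]
    have h3 := mul_le_mul_of_nonneg_left h2 (Real.exp_pos ε).le
    have h4 : δ ≤ δ / ε * (Real.exp ε - 1) := by
      rw [div_mul_eq_mul_div, le_div_iff₀ hε]
      exact mul_le_mul_of_nonneg_left (by linarith [Real.add_one_le_exp ε]) hδ
    linarith

/-- Group privacy for block datasets. -/
lemma IsDP.blockData_le {X J : Type*} [PartialOrder X] {n k : ℕ}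
    {M : (Fin n → X × ℝ) → Measure (X → ℝ)} {ε δ : ℝ} (hε : 0 < ε) (hδ : 0 ≤ δ)
    (hM : IsIsoRegAlg M) (hDP : IsDP NeighborDS M ε δ) {S : Set (X → ℝ)} (hS : MeasurableSet S)
    (e : J × Fin k ↪ Fin n) {lab lab' : J → X × ℝ} {z : X × ℝ}
    (hlab : ∀ j, (lab j).2 ∈ Set.Icc (0 : ℝ) 1) (hlab' : ∀ j, (lab' j).2 ∈ Set.Icc (0 : ℝ) 1)
    (hz : z.2 ∈ Set.Icc (0 : ℝ) 1) {T : Finset J} (h : ∀ j, j ∉ T → lab j = lab' j) :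
    (M (blockData e lab z)).real S ≤
      Real.exp (T.card * k * ε) * ((M (blockData e lab' z)).real S + δ / ε) := by
  have hg := IsDP.group_privacy hε hδ hM hDP hS
    (blockData_induction e (P := fun q => q.2 ∈ Set.Icc (0 : ℝ) 1) hlab' hz)
    ((T ×ˢ Finset.univ).map e) (blockData e lab z)
    (blockData_induction e (P := fun q => q.2 ∈ Set.Icc (0 : ℝ) 1) hlab hz)
    (blockData_eq_of_notMem e z h)
  have hcard : ((((T ×ˢ (Finset.univ : Finset (Fin k))).map e).card : ℕ) : ℝ) = T.card * k := by
    simp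
  rw [hcard] at hg
  have : 0 ≤ δ / ε := by positivity
  linarith

lemma measurableSet_isMonotone01 {X : Type*} [Finite X] [PartialOrder X] :
    MeasurableSet {f : X → ℝ | IsMonotone01 f} := by
  have : {f : X → ℝ | IsMonotone01 f} =
      (⋂ x, ⋂ y, ⋂ (_ : x ≤ y), {f : X → ℝ | f x ≤ f y}) ∩
        ⋂ x, {f : X → ℝ | f x ∈ Set.Icc (0 : ℝ) 1} := by
    ext f
    simp [IsMonotone01, Monotone]
  rw [this]
  refine MeasurableSet.inter ?_ ?_
  · refine MeasurableSet.iInter fun x => MeasurableSet.iInter fun y => MeasurableSet.iInter fun _ =>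
      measurableSet_le (measurable_pi_apply x) (measurable_pi_apply y)
  · exact MeasurableSet.iInter fun x => measurable_pi_apply x measurableSet_Icc

lemma measurableSet_half_le_abs_sub {X : Type*} (x : X) (y : ℝ) :
    MeasurableSet {f : X → ℝ | 1 / 2 ≤ |f x - y|} := by
  have : Measurable fun f : X → ℝ => |f x - y| := by fun_prop
  exact measurableSet_le measurable_const this

lemma abs_sub_mem_Icc {a b : ℝ} (ha : a ∈ Set.Icc (0 : ℝ) 1) (hb : b ∈ Set.Icc (0 : ℝ) 1) :
    |a - b| ∈ Set.Icc (0 : ℝ) 1 :=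
  ⟨abs_nonneg _, abs_le.2 ⟨by linarith [ha.1, hb.2], by linarith [ha.2, hb.1]⟩⟩

lemma IsDistanceBasedLoss.nonneg {ℓ : ℝ → ℝ → ℝ} {R : ℝ} (hℓ : IsDistanceBasedLoss ℓ R) {a b : ℝ}
    (ha : a ∈ Set.Icc (0 : ℝ) 1) (hb : b ∈ Set.Icc (0 : ℝ) 1) : 0 ≤ ℓ a b := by
  obtain ⟨g, -, hg, -, -, h⟩ := hℓ
  rw [h _ _ ha hb]
  exact hg _ (abs_sub_mem_Icc ha hb)

lemma IsDistanceBasedLoss.self_eq_zero {ℓ : ℝ → ℝ → ℝ} {R : ℝ} (hℓ : IsDistanceBasedLoss ℓ R)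
    {a : ℝ} (ha : a ∈ Set.Icc (0 : ℝ) 1) : ℓ a a = 0 := by
  obtain ⟨g, -, -, hg, -, h⟩ := hℓ
  rw [h _ _ ha ha, sub_self, abs_zero, hg]

lemma IsDistanceBasedLoss.le_of_half_le {ℓ : ℝ → ℝ → ℝ} {R : ℝ} (hℓ : IsDistanceBasedLoss ℓ R)
    {a b : ℝ} (ha : a ∈ Set.Icc (0 : ℝ) 1) (hb : b ∈ Set.Icc (0 : ℝ) 1) (hab : 1 / 2 ≤ |a - b|) :
    R ≤ ℓ a b := by
  obtain ⟨g, hmono, -, -, hR, h⟩ := hℓ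
  rw [h _ _ ha hb]
  exact hR.trans (hmono (by norm_num) (abs_sub_mem_Icc ha hb) hab)

lemma IsDistanceBasedLoss.integrable {X : Type*} [PartialOrder X] {ℓ : ℝ → ℝ → ℝ}
    {R : ℝ} (hℓ : IsDistanceBasedLoss ℓ R) {μ : Measure (X → ℝ)} [IsFiniteMeasure μ]
    (hμ : ∀ᵐ f ∂μ, IsMonotone01 f) (x : X) {y : ℝ} (hy : y ∈ Set.Icc (0 : ℝ) 1) :
    Integrable (fun f : X → ℝ => ℓ (f x) y) μ := by
  obtain ⟨g, hmono, hnn, -, -, h⟩ := hℓ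
  have hG : Monotone (Set.IccExtend (zero_le_one (α := ℝ)) ((Set.Icc (0 : ℝ) 1).domRestrict g)) :=
    Monotone.IccExtend _ fun a b hab => hmono a.2 b.2 hab
  have hmeas : Measurable fun f : X → ℝ =>
      Set.IccExtend (zero_le_one (α := ℝ)) ((Set.Icc (0 : ℝ) 1).domRestrict g) |f x - y| :=
    hG.measurable.comp (by fun_prop)
  have hae : (fun f : X → ℝ =>
      Set.IccExtend (zero_le_one (α := ℝ)) ((Set.Icc (0 : ℝ) 1).domRestrict g) |f x - y|) =ᵐ[μ]
        fun f => ℓ (f x) y := by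
    filter_upwards [hμ] with f hf
    rw [h _ _ (hf.2 x) hy, Set.IccExtend_of_mem _ _ (abs_sub_mem_Icc (hf.2 x) hy),
      Set.domRestrict_apply]
  refine Integrable.of_bound (hmeas.aestronglyMeasurable.congr hae) (g 1) ?_
  filter_upwards [hμ] with f hf
  have hm := abs_sub_mem_Icc (hf.2 x) hy
  rw [h _ _ (hf.2 x) hy, Real.norm_of_nonneg (hnn _ hm)]
  exact hmono hm (by norm_num) hm.2

lemma optRisk_nonpos {X : Type*} [PartialOrder X] {ℓ : ℝ → ℝ → ℝ} {R : ℝ}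
    (hℓ : IsDistanceBasedLoss ℓ R) {n : ℕ} {D : Fin n → X × ℝ} (hD : IsDataset D) {g : X → ℝ}
    (hg : IsMonotone01 g) (hfit : ∀ i, g (D i).1 = (D i).2) : optRisk ℓ D ≤ 0 := by
  have hbdd : BddBelow (Set.range fun g : {g : X → ℝ // IsMonotone01 g} => empRisk ℓ g.1 D) := by
    refine ⟨0, ?_⟩
    rintro _ ⟨f, rfl⟩
    exact mul_nonneg (by positivity)
      (Finset.sum_nonneg fun i _ => hℓ.nonneg (f.2.2 _) (hD i))
  refine (ciInf_le hbdd ⟨g, hg⟩).trans (le_of_eq ?_)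
  simp only [empRisk, hfit]
  rw [Finset.sum_eq_zero fun i _ => hℓ.self_eq_zero (hD i), mul_zero]

/-- On a block dataset that some monotone function fits exactly, the expected excess risk is
controlled from below by the probabilities of missing each of the labels by at least `1 / 2`. -/
lemma le_excess_blockData {X J : Type*} [Finite X] [PartialOrder X] [Fintype J] {n k : ℕ}
    {ℓ : ℝ → ℝ → ℝ} {R : ℝ} (hℓ : IsDistanceBasedLoss ℓ R)
    {M : (Fin n → X × ℝ) → Measure (X → ℝ)} (hM : IsIsoRegAlg M)
    (e : J × Fin k ↪ Fin n) {lab : J → X × ℝ} {z : X × ℝ}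
    {g : X → ℝ} (hg : IsMonotone01 g) (hlab : ∀ j, g (lab j).1 = (lab j).2) (hz : g z.1 = z.2) :
    (k : ℝ) / n * R *
        ∑ j, (M (blockData e lab z)).real {f | 1 / 2 ≤ |f (lab j).1 - (lab j).2|} ≤
      (∫ f, empRisk ℓ f (blockData e lab z) ∂(M (blockData e lab z))) -
        optRisk ℓ (blockData e lab z) := by
  have hfit : ∀ i, g (blockData e lab z i).1 = (blockData e lab z i).2 :=
    blockData_induction e (P := fun q => g q.1 = q.2) hlab hz
  set D := blockData e lab z with hDdef
  have hD : IsDataset D := fun i => hfit i ▸ hg.2 _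
  have hprob := (hM D hD).1
  have hae : ∀ᵐ f ∂(M D), IsMonotone01 f :=
    (prob_compl_eq_zero_iff measurableSet_isMonotone01).2 (hM D hD).2
  have hopt := optRisk_nonpos hℓ hD hg hfit
  set B : J → Set (X → ℝ) := fun j => {f | 1 / 2 ≤ |f (lab j).1 - (lab j).2|} with hB
  have hBm : ∀ j, MeasurableSet (B j) := fun j => measurableSet_half_le_abs_sub _ _
  have hint : ∀ j, Integrable ((B j).indicator fun _ => (1 : ℝ)) (M D) := fun j =>
    (integrable_const 1).indicator (hBm j)
  have key : ∫ f, (k : ℝ) / n * R * ∑ j, (B j).indicator (fun _ => (1 : ℝ)) f ∂(M D) ≤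
      ∫ f, empRisk ℓ f D ∂(M D) := by
    refine integral_mono_ae ((integrable_finsetSum _ fun j _ => hint j).const_mul _)
      ((integrable_finsetSum _ fun i _ => hℓ.integrable hae (D i).1 (hD i)).const_mul _) ?_
    filter_upwards [hae] with f hf
    have h1 : ∑ p : J × Fin k, ℓ (f (D (e p)).1) (D (e p)).2 ≤ ∑ i, ℓ (f (D i).1) (D i).2 := by
      rw [← Finset.sum_map Finset.univ e fun i => ℓ (f (D i).1) (D i).2]
      exact Finset.sum_le_sum_of_subset_of_nonneg (Finset.subset_univ _)
        fun i _ _ => hℓ.nonneg (hf.2 _) (hD i)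
    have h2 : ∑ p : J × Fin k, ℓ (f (D (e p)).1) (D (e p)).2 =
        k * ∑ j, ℓ (f (lab j).1) (lab j).2 := by
      simp_rw [hDdef, blockData_apply]
      rw [Fintype.sum_prod_type]
      simp [Finset.mul_sum]
    have h3 : ∑ j, R * (B j).indicator (fun _ => (1 : ℝ)) f ≤ ∑ j, ℓ (f (lab j).1) (lab j).2 := by
      refine Finset.sum_le_sum fun j _ => ?_
      have hj : (lab j).2 ∈ Set.Icc (0 : ℝ) 1 := hlab j ▸ hg.2 _
      by_cases hfj : f ∈ B j
      · simpa [hfj] using hℓ.le_of_half_le (hf.2 _) hj hfj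
      · simpa [hfj] using hℓ.nonneg (hf.2 _) hj
    calc (k : ℝ) / n * R * ∑ j, (B j).indicator (fun _ => (1 : ℝ)) f
        = 1 / (n : ℝ) * (k * ∑ j, R * (B j).indicator (fun _ => (1 : ℝ)) f) := by
          rw [← Finset.mul_sum]
          ring
      _ ≤ 1 / (n : ℝ) * (k * ∑ j, ℓ (f (lab j).1) (lab j).2) := by gcongr
      _ ≤ empRisk ℓ f D := by
          rw [← h2]
          exact mul_le_mul_of_nonneg_left h1 (by positivity)
  rw [integral_const_mul, integral_finsetSum _ fun j _ => hint j] at key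
  have hreal : ∀ j, ∫ f, (B j).indicator (fun _ => (1 : ℝ)) f ∂(M D) = (M D).real (B j) :=
    fun j => integral_indicator_one (hBm j)
  simp_rw [hreal] at key
  linarith

/-- The indicator function of an upper set is monotone. -/
lemma isMonotone01_indicator {X : Type*} [PartialOrder X] {U : Set X} (hU : IsUpperSet U) :
    IsMonotone01 (U.indicator fun _ => (1 : ℝ)) := by
  classical
  refine ⟨fun x y hxy => ?_, fun x => ?_⟩
  · by_cases hx : x ∈ U
    · simp [hx, hU hxy hx]
    · simp only [hx, not_false_eq_true, Set.indicator_of_notMem]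
      exact Set.indicator_nonneg (fun _ _ => zero_le_one) _
  · by_cases hx : x ∈ U <;> simp [hx]

/-- The label `0` or `1` encoded by a Boolean. -/
def boolLabel (b : Bool) : ℝ := if b then 1 else 0

lemma boolLabel_mem_Icc (b : Bool) : boolLabel b ∈ Set.Icc (0 : ℝ) 1 := by
  cases b <;> simp [boolLabel]

/-- If `m` points of an antichain admit arbitrary labels, and a padding point can carry label `1`
independently of these, the excess risk is proportional to the total size of the blocks. -/
lemma exists_le_excess_of_antichain {X : Type*} [Finite X] [PartialOrder X] {n k m : ℕ}
    {ℓ : ℝ → ℝ → ℝ} {R : ℝ} (hℓ : IsDistanceBasedLoss ℓ R) (hR : 0 ≤ R)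
    {M : (Fin n → X × ℝ) → Measure (X → ℝ)} {ε δ : ℝ} (hε : 0 < ε) (hδ : 0 ≤ δ)
    (hδε : δ / ε ≤ 0.01) (hM : IsIsoRegAlg M) (hDP : IsDP NeighborDS M ε δ)
    (a : Fin m → X) (ha : ∀ i j, a i ≤ a j → i = j) (a₀ : X) (ha₀ : ∀ j, ¬ a₀ ≤ a j)
    (hkε : k * ε ≤ 1) (hkn : m * k ≤ n) :
    ∃ D : Fin n → X × ℝ, IsDataset D ∧
      (k : ℝ) / n * R * (0.15 * m) ≤ (∫ f, empRisk ℓ f D ∂(M D)) - optRisk ℓ D := by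
  classical
  obtain ⟨e⟩ : Nonempty (Fin m × Fin k ↪ Fin n) :=
    Function.Embedding.nonempty_of_card_le (by simpa using hkn)
  set lab : (Fin m → Bool) → Fin m → X × ℝ := fun b j => (a j, boolLabel (b j)) with hlab
  have hlabv : ∀ b j, (lab b j).2 ∈ Set.Icc (0 : ℝ) 1 := fun b j => boolLabel_mem_Icc _
  have hzv : ((a₀, 1) : X × ℝ).2 ∈ Set.Icc (0 : ℝ) 1 := by simp
  have hDv : ∀ b, IsDataset (blockData e (lab b) (a₀, 1)) := fun b =>
    blockData_induction e (P := fun q => q.2 ∈ Set.Icc (0 : ℝ) 1) (hlabv b) hzv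
  set err : (Fin m → Bool) → Fin m → ℝ := fun b j =>
    (M (blockData e (lab b) (a₀, 1))).real {f | 1 / 2 ≤ |f (lab b j).1 - (lab b j).2|} with herr
  let flip : Fin m → (Fin m → Bool) → (Fin m → Bool) := fun j b => Function.update b j (!b j)
  have hflip : ∀ j, Function.Involutive (flip j) := fun j b => by simp [flip]
  have hpair : ∀ b j, 0.3 ≤ err b j + err (flip j b) j := by
    intro b j
    have hp := (hM _ (hDv b)).1
    have hmeas := measurableSet_half_le_abs_sub (lab (flip j b) j).1 (lab (flip j b) j).2
    have hpriv := IsDP.blockData_le hε hδ hM hDP hmeas e (hlabv b) (hlabv (flip j b)) hzv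
      (T := {j}) (fun i hi => by
        have hij : i ≠ j := by simpa using hi
        simp [hlab, flip, hij])
    have hcover : 1 ≤ err b j + (M (blockData e (lab b) (a₀, 1))).real
        {f | 1 / 2 ≤ |f (lab (flip j b) j).1 - (lab (flip j b) j).2|} := by
      have hun : {f : X → ℝ | 1 / 2 ≤ |f (lab b j).1 - (lab b j).2|} ∪
          {f | 1 / 2 ≤ |f (lab (flip j b) j).1 - (lab (flip j b) j).2|} = Set.univ := by
        refine Set.eq_univ_of_forall fun f => ?_
        by_contra hf
        simp only [Set.mem_union, Set.mem_ofPred_eq, not_or, not_le, abs_lt, hlab, flip,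
          Function.update_self] at hf
        cases hb : b j <;> simp [hb, boolLabel] at hf <;> linarith
      calc (1 : ℝ) = (M (blockData e (lab b) (a₀, 1))).real Set.univ := probReal_univ.symm
        _ ≤ _ := hun ▸ measureReal_union_le _ _
    have hexp : Real.exp ((({j} : Finset (Fin m)).card : ℝ) * k * ε) ≤ 2.7182818286 := by
      refine le_trans (Real.exp_le_exp.2 ?_) Real.exp_one_lt_d9.le
      simpa using hkε
    have he0 : 0 ≤ err b j := measureReal_nonneg
    have he1 : 0 ≤ err (flip j b) j := measureReal_nonneg
    have hd : 0 ≤ δ / ε := by positivity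
    have := mul_le_mul_of_nonneg_right hexp (add_nonneg he1 hd)
    linarith
  have havg : ∑ _b : Fin m → Bool, 0.15 * (m : ℝ) ≤ ∑ b, ∑ j, err b j := by
    rw [Finset.sum_comm]
    have hj : ∀ j, ∑ _b : Fin m → Bool, (0.15 : ℝ) ≤ ∑ b, err b j := by
      intro j
      have h1 : ∑ b, err (flip j b) j = ∑ b, err b j :=
        Equiv.sum_comp (hflip j).toPerm fun b => err b j
      have h2 := Finset.sum_le_sum fun b (_ : b ∈ Finset.univ) => hpair b j
      rw [Finset.sum_add_distrib, h1] at h2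
      simp only [Finset.sum_const, nsmul_eq_mul] at h2 ⊢
      linarith
    refine le_trans (le_of_eq ?_) (Finset.sum_le_sum fun j _ => hj j)
    simp only [Finset.sum_const, nsmul_eq_mul, Finset.card_univ, Fintype.card_fin]
    ring
  obtain ⟨b, -, hb⟩ := Finset.exists_le_of_sum_le Finset.univ_nonempty havg
  refine ⟨blockData e (lab b) (a₀, 1), hDv b, ?_⟩
  have hU : IsUpperSet {x : X | a₀ ≤ x ∨ ∃ j, b j = true ∧ a j ≤ x} := by
    rintro x y hxy (h | ⟨j, hj, h⟩)
    · exact Or.inl (h.trans hxy)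
    · exact Or.inr ⟨j, hj, h.trans hxy⟩
  refine le_trans ?_ (le_excess_blockData hℓ hM e (isMonotone01_indicator hU) (fun j => ?_) ?_)
  · exact mul_le_mul_of_nonneg_left hb (by positivity)
  · cases hbj : b j
    · have : ¬ (a₀ ≤ a j ∨ ∃ i, b i = true ∧ a i ≤ a j) := by
        rintro (h | ⟨i, hi, h⟩)
        · exact ha₀ j h
        · rw [ha i j h, hbj] at hi
          exact Bool.false_ne_true hi
      simp [hlab, hbj, boolLabel, Set.indicator, this]
    · have : a₀ ≤ a j ∨ ∃ i, b i = true ∧ a i ≤ a j := Or.inr ⟨j, hbj, le_rfl⟩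
      simp [hlab, hbj, boolLabel, Set.indicator, this]
  · simp

/-- Packing lower bound along a chain. -/
lemma exists_le_excess_of_chain {X : Type*} [Finite X] [PartialOrder X] {n k : ℕ}
    {ℓ : ℝ → ℝ → ℝ} {R : ℝ} (hℓ : IsDistanceBasedLoss ℓ R) (hR : 0 ≤ R)
    {M : (Fin n → X × ℝ) → Measure (X → ℝ)} {ε δ : ℝ} (hε : 0 < ε) (hδ : 0 ≤ δ)
    (hM : IsIsoRegAlg M) (hDP : IsDP NeighborDS M ε δ)
    (p : LTSeries X) (hp : 0 < p.length) (hδε : p.length * (δ / ε) ≤ 0.01)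
    (hkε : Real.exp (2 * k * ε) ≤ p.length / 2) (hkn : 2 * k ≤ n) :
    ∃ D : Fin n → X × ℝ, IsDataset D ∧
      (k : ℝ) / n * R * 0.25 ≤ (∫ f, empRisk ℓ f D ∂(M D)) - optRisk ℓ D := by
  classical
  obtain ⟨e⟩ : Nonempty (Bool × Fin k ↪ Fin n) :=
    Function.Embedding.nonempty_of_card_le (by simpa using hkn)
  set lab : Fin p.length → Bool → X × ℝ := fun i b =>
    (if b then p i.succ else p i.castSucc, boolLabel b) with hlab
  have hlabv : ∀ i b, (lab i b).2 ∈ Set.Icc (0 : ℝ) 1 := fun i b => boolLabel_mem_Icc _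
  have hzv : ((p.last, 1) : X × ℝ).2 ∈ Set.Icc (0 : ℝ) 1 := by simp
  set D : Fin p.length → Fin n → X × ℝ := fun i => blockData e (lab i) (p.last, 1) with hD
  have hDv : ∀ i, IsDataset (D i) := fun i =>
    blockData_induction e (P := fun q => q.2 ∈ Set.Icc (0 : ℝ) 1) (hlabv i) hzv
  set B : Fin p.length → Bool → Set (X → ℝ) := fun i b =>
    {f | 1 / 2 ≤ |f (lab i b).1 - (lab i b).2|} with hB
  have hBm : ∀ i b, MeasurableSet (B i b) := fun i b => measurableSet_half_le_abs_sub _ _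
  obtain ⟨i, hi⟩ : ∃ i, 0.25 ≤ ∑ b, (M (D i)).real (B i b) := by
    by_contra! hcon
    set G : Fin p.length → Set (X → ℝ) := fun i => (B i true ∪ B i false)ᶜ ∩ {f | IsMonotone01 f}
      with hG
    have hGm : ∀ i, MeasurableSet (G i) := fun i =>
      ((hBm i _).union (hBm i _)).compl.inter measurableSet_isMonotone01
    have hG_prob : ∀ i, 0.75 ≤ (M (D i)).real (G i) := by
      intro i
      have := (hM _ (hDv i)).1
      have hae : ∀ᵐ f ∂(M (D i)), IsMonotone01 f :=
        (prob_compl_eq_zero_iff measurableSet_isMonotone01).2 (hM _ (hDv i)).2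
      have h1 : (M (D i)).real (G i) = (M (D i)).real (B i true ∪ B i false)ᶜ :=
        measureReal_congr (by
          filter_upwards [hae] with f hf
          exact propext ⟨fun h => h.1, fun h => ⟨h, hf⟩⟩)
      rw [h1, probReal_compl_eq_one_sub ((hBm i _).union (hBm i _))]
      have h2 := measureReal_union_le (μ := M (D i)) (B i true) (B i false)
      have h3 := hcon i
      rw [Fintype.sum_bool] at h3
      linarith
    have hdisj : Pairwise fun i j => Disjoint (G i) (G j) := by
      have hlt : ∀ i j, i < j → Disjoint (G i) (G j) := by
        intro i j hij
        refine Set.disjoint_left.2 fun f hfi hfj => ?_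
        have h1 : f (p i.succ) ≤ f (p j.castSucc) :=
          hfi.2.1 (p.strictMono.monotone (Fin.succ_le_castSucc_iff.2 hij))
        have h2 := hfi.1
        have h3 := hfj.1
        simp only [hB, hlab, Set.mem_compl_iff, Set.mem_union, Set.mem_ofPred_eq, not_or, not_le,
          abs_lt, boolLabel, if_true, Bool.false_eq_true, if_false] at h2 h3
        linarith [h2.1.1, h3.2.2]
      intro i j hij
      rcases lt_or_gt_of_ne hij with h | h
      · exact hlt i j h
      · exact (hlt j i h).symm
    set i₀ : Fin p.length := ⟨0, hp⟩
    have hi₀ := (hM _ (hDv i₀)).1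
    have hpriv : ∀ i, 0.75 ≤ Real.exp (2 * k * ε) * ((M (D i₀)).real (G i) + δ / ε) := by
      intro i
      have h := IsDP.blockData_le hε hδ hM hDP (hGm i) e (hlabv i) (hlabv i₀) hzv
        (T := Finset.univ) (by simp)
      simp only [Finset.card_univ, Fintype.card_bool, Nat.cast_ofNat] at h
      exact (hG_prob i).trans h
    have hsum : ∑ i, (M (D i₀)).real (G i) ≤ 1 := by
      rw [← measureReal_iUnion_fintype hdisj hGm]
      exact measureReal_le_one
    have h := Finset.sum_le_sum fun i (_ : i ∈ Finset.univ) => hpriv i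
    rw [← Finset.mul_sum, Finset.sum_add_distrib] at h
    simp only [Finset.sum_const, nsmul_eq_mul, Finset.card_univ, Fintype.card_fin] at h
    have hlen : (0 : ℝ) < p.length := by exact_mod_cast hp
    have h4 : Real.exp (2 * k * ε) * (∑ i, (M (D i₀)).real (G i) + p.length * (δ / ε)) ≤
        (p.length / 2 : ℝ) * 1.01 :=
      mul_le_mul hkε (by linarith) (by positivity) (by positivity)
    linarith
  refine ⟨D i, hDv i, ?_⟩
  have hmono := isMonotone01_indicator (isUpperSet_Ici (p i.succ))
  refine le_trans ?_ (le_excess_blockData hℓ hM e hmono (fun b => ?_) ?_)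
  · exact mul_le_mul_of_nonneg_left hi (by positivity)
  · cases b
    · have : ¬ p i.succ ≤ p i.castSucc := not_le_of_gt (p.strictMono i.castSucc_lt_succ)
      simp [hlab, boolLabel, this]
    · simp [hlab, boolLabel]
  · have : p i.succ ≤ p.last := p.strictMono.monotone (Fin.le_last _)
    simp [this]

lemma bddAbove_card_antichain (X : Type*) [Fintype X] [PartialOrder X] :
    BddAbove {k | ∃ A : Finset X, IsAntichain (· ≤ ·) (A : Set X) ∧ A.card = k} := by
  refine ⟨Fintype.card X, ?_⟩
  rintro _ ⟨A, -, rfl⟩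
  exact Finset.card_le_univ A

lemma exists_antichain_card_eq_posetWidth (X : Type*) [Fintype X] [PartialOrder X] :
    ∃ A : Finset X, IsAntichain (· ≤ ·) (A : Set X) ∧ A.card = posetWidth X :=
  Nat.sSup_mem (s := {k | ∃ A : Finset X, IsAntichain (· ≤ ·) (A : Set X) ∧ A.card = k})
    ⟨0, ∅, by simp, rfl⟩ (bddAbove_card_antichain X)

/-- Mirsky's theorem, in the form of a bound on the cardinality of a poset. -/
lemma exists_ltSeries_card_le (X : Type*) [Fintype X] [PartialOrder X] [Nonempty X] :
    ∃ p : LTSeries X, Fintype.card X ≤ posetWidth X * (p.length + 1) := by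
  classical
  have hfin : ∀ x : X, Order.height x ≠ ⊤ := by
    intro x
    refine ne_top_of_le_ne_top (ENat.natCast_ne_top (Fintype.card X)) ?_
    refine Order.height_le fun p _ => ?_
    exact_mod_cast p.length_lt_card.le
  obtain ⟨x, hx⟩ := Finite.exists_max fun x : X => (Order.height x).toNat
  obtain ⟨p, -, hp⟩ := Order.exists_series_of_height_eq_coe x
    (ENat.natCast_toNat (hfin x)).symm
  refine ⟨p, ?_⟩
  have h := Finset.card_le_mul_card_image_of_maps_to (s := (Finset.univ : Finset X))
    (t := Finset.range (p.length + 1)) (f := fun x : X => (Order.height x).toNat)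
    (fun y _ => Finset.mem_range.2 (by have := hx y; omega)) (posetWidth X) (fun i _ => ?_)
  · simpa using h
  · refine le_csSup (bddAbove_card_antichain X) ⟨_, ?_, rfl⟩
    intro y hy z hz hyz hle
    have hlt : Order.height y < Order.height z :=
      Order.height_strictMono (lt_of_le_of_ne hle hyz) (lt_top_iff_ne_top.2 (hfin y))
    rw [← ENat.natCast_toNat (hfin y), ← ENat.natCast_toNat (hfin z)] at hlt
    simp only [Finset.coe_filter, Finset.mem_univ, true_and, Set.mem_ofPred_eq] at hy hz
    have : (Order.height y).toNat < (Order.height z).toNat := by exact_mod_cast hlt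
    omega

/-- Every poset with at least two elements has an antichain of about half its width, together
with a point that is below no element of the antichain. -/
lemma exists_antichain_and_point (X : Type*) [Fintype X] [PartialOrder X]
    (hX : 2 ≤ Fintype.card X) :
    ∃ (w : ℕ) (a : Fin w → X) (a₀ : X), 1 ≤ w ∧ posetWidth X ≤ 2 * w ∧
      (∀ i j, a i ≤ a j → i = j) ∧ ∀ j, ¬ a₀ ≤ a j := by
  classical
  rcases le_or_gt (posetWidth X) 2 with hw | hw
  · obtain ⟨u, v, huv⟩ := Fintype.one_lt_card_iff.1 hX
    rcases em (u ≤ v) with h | h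
    · exact ⟨1, fun _ => u, v, le_rfl, hw, fun i j _ => Subsingleton.elim i j,
        fun _ h' => huv (h.antisymm h')⟩
    · exact ⟨1, fun _ => v, u, le_rfl, hw, fun i j _ => Subsingleton.elim i j, fun _ => h⟩
  · obtain ⟨A, hA, hcard⟩ := exists_antichain_card_eq_posetWidth X
    obtain ⟨a₀, ha₀⟩ : A.Nonempty := Finset.card_pos.1 (by omega)
    have hcard' : (A.erase a₀).card = posetWidth X - 1 := by
      rw [Finset.card_erase_of_mem ha₀, hcard]
    let b := (A.erase a₀).equivFinOfCardEq hcard'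
    have hb : ∀ j, (b.symm j : X) ≠ a₀ ∧ (b.symm j : X) ∈ A := fun j =>
      Finset.mem_erase.1 (b.symm j).2
    refine ⟨posetWidth X - 1, fun j => b.symm j, a₀, by omega, by omega, fun i j hij => ?_,
      fun j hj => ?_⟩
    · exact b.symm.injective (Subtype.ext (hA.eq (hb i).2 (hb j).2 hij))
    · exact (hb j).1 (hA.eq ha₀ (hb j).2 hj).symm

/-- Choice of the block size and of the number of blocks for the antichain construction. -/
lemma exists_block_size_antichain {n w : ℕ} (hn : 1 ≤ n) (hw : 1 ≤ w) {ε : ℝ} (hε : 0 < ε)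
    (hε1 : ε ≤ 1) :
    ∃ k m : ℕ, k * ε ≤ 1 ∧ m * k ≤ n ∧ m ≤ w ∧
      1 / 2 * min 1 ((w : ℝ) / (ε * n)) ≤ (k : ℝ) / n * m := by
  have hn0 : (0 : ℝ) < n := by exact_mod_cast hn
  set q : ℕ := ⌊1 / ε⌋₊ with hq
  have hqle : (q : ℝ) * ε ≤ 1 := by
    have := Nat.floor_le (show 0 ≤ 1 / ε by positivity)
    rwa [le_div_iff₀ hε] at this
  have hq1 : 1 ≤ q := Nat.le_floor (by rw [Nat.cast_one, le_div_iff₀ hε]; linarith)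
  have hqge : 1 / ε ≤ 2 * q := by
    have := Nat.lt_floor_add_one (1 / ε)
    have h1 : (1 : ℝ) ≤ q := by exact_mod_cast hq1
    linarith
  rcases le_or_gt (w * q) n with h | h
  · refine ⟨q, w, hqle, h, le_rfl, ?_⟩
    refine (mul_le_mul_of_nonneg_left (min_le_right _ _) (by norm_num)).trans ?_
    have : (1 : ℝ) / 2 * (w / (ε * n)) = (1 / ε) * (w / (2 * n)) := by field_simp
    rw [this]
    refine (mul_le_mul_of_nonneg_right hqge (by positivity)).trans (le_of_eq ?_)
    field_simp
  have hmin : 1 / 2 * min 1 ((w : ℝ) / (ε * n)) ≤ 1 / 2 := by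
    linarith [min_le_left 1 ((w : ℝ) / (ε * n))]
  rcases le_or_gt n q with h' | h'
  · refine ⟨n, 1, ?_, by omega, hw, ?_⟩
    · have : (n : ℝ) ≤ q := by exact_mod_cast h'
      exact (mul_le_mul_of_nonneg_right this hε.le).trans hqle
    · rw [div_self hn0.ne', Nat.cast_one]
      linarith
  · refine ⟨q, n / q, hqle, Nat.div_mul_le_self n q, ?_, hmin.trans ?_⟩
    · exact Nat.div_le_of_le_mul (by rw [mul_comm]; exact h.le)
    · have h1 : n < q * (n / q) + q := by
        have := Nat.div_add_mod n q
        have := Nat.mod_lt n hq1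
        omega
      have h2 : q * 1 ≤ q * (n / q) :=
        Nat.mul_le_mul_left q ((Nat.one_le_div_iff hq1).2 h'.le)
      have h3 : n ≤ 2 * (q * (n / q)) := by omega
      have h4 : (n : ℝ) ≤ 2 * (q * ((n / q : ℕ) : ℝ)) := by exact_mod_cast h3
      rw [div_mul_eq_mul_div, le_div_iff₀ hn0]
      linarith

/-- Choice of the block size for the chain construction. -/
lemma exists_block_size_chain {n : ℕ} (hn : 2 ≤ n) {L : ℝ} (hL : 2 ≤ L) {ε : ℝ} (hε : 0 < ε)
    (hε1 : ε ≤ 1) :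
    ∃ k : ℕ, 2 * k * ε ≤ L ∧ 2 * k ≤ n ∧ 1 / 4 * min 1 (L / (ε * n)) ≤ (k : ℝ) / n := by
  have hn0 : (0 : ℝ) < n := by exact_mod_cast (by omega : 0 < n)
  set q : ℕ := ⌊L / (2 * ε)⌋₊ with hq
  have hqle : 2 * (q : ℝ) * ε ≤ L := by
    have := Nat.floor_le (show 0 ≤ L / (2 * ε) by positivity)
    rw [le_div_iff₀ (by positivity)] at this
    linarith
  have hq1 : 1 ≤ q := Nat.le_floor (by rw [Nat.cast_one, le_div_iff₀ (by positivity)]; linarith)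
  have hqge : L / (2 * ε) ≤ 2 * q := by
    have := Nat.lt_floor_add_one (L / (2 * ε))
    have h1 : (1 : ℝ) ≤ q := by exact_mod_cast hq1
    linarith
  rcases le_or_gt (2 * q) n with h | h
  · refine ⟨q, hqle, h, ?_⟩
    refine (mul_le_mul_of_nonneg_left (min_le_right _ _) (by norm_num)).trans ?_
    have : (1 : ℝ) / 4 * (L / (ε * n)) = L / (2 * ε) / (2 * n) := by field_simp; norm_num
    rw [this, div_le_div_iff₀ (by positivity) hn0]
    have := mul_le_mul_of_nonneg_right hqge hn0.le
    linarith
  · refine ⟨n / 2, ?_, Nat.mul_div_le n 2, ?_⟩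
    · have h1 : ((n / 2 : ℕ) : ℝ) ≤ q := by exact_mod_cast (by omega : n / 2 ≤ q)
      have := mul_le_mul_of_nonneg_right h1 hε.le
      linarith
    · have h1 : (n : ℝ) ≤ 4 * ((n / 2 : ℕ) : ℝ) := by exact_mod_cast (by omega : n ≤ 4 * (n / 2))
      rw [le_div_iff₀ hn0]
      have := mul_le_mul_of_nonneg_right (min_le_left 1 (L / (ε * n))) hn0.le
      linarith

lemma min_one_div_le_mul {C S T s : ℝ} (hC : 1 ≤ C) (hs : 0 < s) (h : S ≤ C * T) :
    min 1 (S / s) ≤ C * min 1 (T / s) := by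
  rcases le_total 1 (T / s) with h1 | h1
  · rw [min_eq_left h1]
    linarith [min_le_left 1 (S / s)]
  · rw [min_eq_right h1, ← mul_div_assoc]
    exact (min_le_right _ _).trans (by gcongr)

/-- The lower bound for nonnegative `R`. -/
lemma exists_le_excess {X : Type*} [Fintype X] [PartialOrder X] (hX : 2 ≤ Fintype.card X)
    {ℓ : ℝ → ℝ → ℝ} {R : ℝ} (hℓ : IsDistanceBasedLoss ℓ R) (hR : 0 ≤ R) {n : ℕ} (hn : 1 ≤ n)
    {ε δ : ℝ} (hε : 0 < ε) (hε1 : ε ≤ 1) (hδ : 0 ≤ δ) (hδε : δ < 0.01 * ε / Fintype.card X)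
    {M : (Fin n → X × ℝ) → Measure (X → ℝ)} (hM : IsIsoRegAlg M)
    (hDP : IsDP NeighborDS M ε δ) :
    ∃ D : Fin n → X × ℝ, IsDataset D ∧
      0.005 * R * min 1 (((posetWidth X : ℝ) + Real.log (Fintype.card X)) / (ε * n)) ≤
        (∫ f, empRisk ℓ f D ∂(M D)) - optRisk ℓ D := by
  have hn0 : (0 : ℝ) < n := by exact_mod_cast hn
  have hN : (0 : ℝ) < Fintype.card X := by exact_mod_cast (by omega : 0 < Fintype.card X)
  have hs : 0 < ε * n := by positivity
  have hη : Fintype.card X * (δ / ε) ≤ 0.01 := by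
    rw [lt_div_iff₀ hN] at hδε
    rw [← mul_div_assoc, div_le_iff₀ hε]
    linarith
  have hd : 0 ≤ δ / ε := by positivity
  have hη1 : δ / ε ≤ 0.01 := by
    have : (1 : ℝ) ≤ Fintype.card X := by exact_mod_cast (by omega : 1 ≤ Fintype.card X)
    nlinarith
  have : Nonempty X := Fintype.card_pos_iff.1 (by omega)
  obtain ⟨p, hp⟩ := exists_ltSeries_card_le X
  obtain ⟨w, a, a₀, hw, hwidth, ha, ha₀⟩ := exists_antichain_and_point X hX
  have hw0 : (1 : ℝ) ≤ w := by exact_mod_cast hw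
  have hT : (posetWidth X : ℝ) + Real.log (Fintype.card X) ≤
      4 * w + Real.log ((p.length : ℝ) + 1) := by
    have hpw : 0 < posetWidth X := by
      by_contra h0
      have h1 : posetWidth X = 0 := by omega
      rw [h1, zero_mul] at hp
      omega
    have hpw' : (0 : ℝ) < posetWidth X := by exact_mod_cast hpw
    have h1 : Real.log (Fintype.card X) ≤
        Real.log (posetWidth X) + Real.log ((p.length : ℝ) + 1) := by
      rw [← Real.log_mul hpw'.ne' (by positivity)]
      exact Real.log_le_log hN (by exact_mod_cast hp)
    have h2 := Real.log_le_sub_one_of_pos hpw'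
    have h3 : (posetWidth X : ℝ) ≤ 2 * w := by exact_mod_cast hwidth
    linarith
  have of_width : ∀ {S : ℝ}, min 1 (S / (ε * n)) ≤ 10 * min 1 (w / (ε * n)) →
      ∃ D : Fin n → X × ℝ, IsDataset D ∧ 0.005 * R * min 1 (S / (ε * n)) ≤
        (∫ f, empRisk ℓ f D ∂(M D)) - optRisk ℓ D := by
    intro S hS
    obtain ⟨k, m, hk, hkm, hmw, hkn⟩ := exists_block_size_antichain hn hw hε hε1
    obtain ⟨D, hD, hle⟩ := exists_le_excess_of_antichain hℓ hR hε hδ hη1 hM hDP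
      (fun i => a (Fin.castLE hmw i)) (fun i j hij => Fin.castLE_injective hmw (ha _ _ hij)) a₀
      (fun j => ha₀ _) hk hkm
    refine ⟨D, hD, le_trans ?_ hle⟩
    have h1 : min 1 (S / (ε * n)) ≤ 20 * ((k : ℝ) / n * m) := by linarith
    have h2 := mul_le_mul_of_nonneg_left h1 hR
    have h3 : 0 ≤ R * ((k : ℝ) / n * m) := by positivity
    linarith
  rcases le_or_gt (Real.log ((p.length : ℝ) + 1)) 6 with hH | hH
  · exact of_width (min_one_div_le_mul (by norm_num) hs (by linarith))
  have hlen0 : 0 < p.length := by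
    rcases Nat.eq_zero_or_pos p.length with h0 | h0
    · norm_num [h0] at hH
    · exact h0
  have hlen : (1 : ℝ) ≤ p.length := by exact_mod_cast hlen0
  set L := Real.log ((p.length : ℝ) / 2) with hL
  have hLH : Real.log ((p.length : ℝ) + 1) ≤ L + 3 := by
    have h1 : Real.log ((p.length : ℝ) + 1) ≤ Real.log (p.length / 2 * 4) :=
      Real.log_le_log (by positivity) (by linarith)
    rw [Real.log_mul (by positivity) (by norm_num)] at h1
    have := Real.log_le_sub_one_of_pos (show (0 : ℝ) < 4 by norm_num)
    linarith
  rcases le_or_gt L w with hLw | hLw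
  · exact of_width (min_one_div_le_mul (by norm_num) hs (by linarith))
  rcases Nat.lt_or_ge n 2 with hn2 | hn2
  · obtain rfl : n = 1 := by omega
    refine of_width ?_
    have h1 : (1 : ℝ) ≤ w / (ε * (1 : ℕ)) := by
      rw [le_div_iff₀ hs, Nat.cast_one]
      linarith
    rw [min_eq_left h1]
    exact (min_le_left _ _).trans (by norm_num)
  obtain ⟨k, hk, hkn, hkL⟩ := exists_block_size_chain hn2 (show 2 ≤ L by linarith) hε hε1
  have hexp : Real.exp (2 * k * ε) ≤ p.length / 2 := by
    rw [← Real.exp_log (show (0 : ℝ) < p.length / 2 by positivity)]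
    exact Real.exp_le_exp.2 hk
  have hpη : p.length * (δ / ε) ≤ 0.01 := by
    refine le_trans (mul_le_mul_of_nonneg_right ?_ hd) hη
    exact_mod_cast p.length_lt_card.le
  obtain ⟨D, hD, hle⟩ := exists_le_excess_of_chain hℓ hR hε hδ hM hDP p hlen0 hpη hexp hkn
  refine ⟨D, hD, le_trans ?_ hle⟩
  have h0 := min_one_div_le_mul (C := 8) (by norm_num) hs
    (show (posetWidth X : ℝ) + Real.log (Fintype.card X) ≤ 8 * L by linarith)
  have h1 : min 1 (((posetWidth X : ℝ) + Real.log (Fintype.card X)) / (ε * n)) ≤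
      32 * ((k : ℝ) / n) := by linarith
  have h2 := mul_le_mul_of_nonneg_left h1 hR
  have h3 : 0 ≤ R * ((k : ℝ) / n) := by positivity
  linarith

/-- **Theorem 13 (Lower Bound for General Posets).** There is a universal constant
`c > 0` such that for every finite poset `X` with `|X| ≥ 2`, any `R`-distance-based loss
`ℓ`, any `n ≥ 1`, `ε ∈ (0,1]` and `0 ≤ δ < 0.01·ε/|X|`, every `(ε,δ)`-DP
isotonic-regression mechanism has, on some dataset, expected excess empirical risk at
least `c · R · min{1, (width(X) + log|X|)/(εn)}`. -/
theorem dp_isotonic_regression_general_poset_lower_bound :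
    ∃ c : ℝ, 0 < c ∧
      ∀ (X : Type) [Fintype X] [PartialOrder X],
        2 ≤ Fintype.card X →
        ∀ (ℓ : ℝ → ℝ → ℝ) (R : ℝ), IsDistanceBasedLoss ℓ R →
        ∀ n : ℕ, 1 ≤ n →
        ∀ ε δ : ℝ, ε ∈ Set.Ioc (0 : ℝ) 1 → 0 ≤ δ → δ < 0.01 * ε / (Fintype.card X : ℝ) →
        ∀ M : (Fin n → X × ℝ) → Measure (X → ℝ),
          IsIsoRegAlg M →
          IsDP NeighborDS M ε δ →
          ∃ D : Fin n → X × ℝ, IsDataset D ∧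
            c * R * min 1 (((posetWidth X : ℝ) + Real.log (Fintype.card X)) / (ε * n)) ≤
              (∫ f, empRisk ℓ f D ∂(M D)) - optRisk ℓ D := by
  refine ⟨0.005, by norm_num, ?_⟩
  intro X _ _ hX ℓ R hℓ n hn ε δ hε hδ hδε M hM hDP
  rcases le_total 0 R with hR | hR
  · exact exists_le_excess hX hℓ hR hn hε.1 hε.2 hδ hδε hM hDP
  · have hℓ₀ : IsDistanceBasedLoss ℓ 0 := by
      obtain ⟨g, h1, h2, h3, -, h5⟩ := hℓ
      exact ⟨g, h1, h2, h3, h2 _ (by norm_num), h5⟩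
    obtain ⟨D, hD, hle⟩ := exists_le_excess hX hℓ₀ le_rfl hn hε.1 hε.2 hδ hδε hM hDP
    refine ⟨D, hD, le_trans ?_ hle⟩
    have hε0 := hε.1.le
    have hmin : 0 ≤ min 1 (((posetWidth X : ℝ) + Real.log (Fintype.card X)) / (ε * n)) :=
      le_min zero_le_one (by positivity)
    rw [mul_zero, zero_mul]
    exact mul_nonpos_of_nonpos_of_nonneg (by linarith) hmin
end
end

section
/- There is a universal constant C > 0 such that the following holds. Let X = {1,...,m} with the usual total order, let ℓ : [0,1]×[0,1] → ℝ≥0 be an L-Lipschitz loss function, let ε > 0 and n ≥ 1 with m ≥ max{n, 2}. Then there exists a randomized algorithm M mapping each dataset D ∈ (X×[0,1])^n to a probability distribution over monotone functions f : X → [0,1], such that M is ε-differentially private and for every dataset D, the expected excess empirical risk E_{f∼M(D)}[L_ℓ(f;D)] − min_{g monotone} L_ℓ(g;D) is at most C · L · sqrt((log m)/(εn)). -/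
open MeasureTheory

noncomputable section

/-- The Gibbs distribution with energies `s` on a finite type. -/
def gibbs {ι : Type*} [Fintype ι] (s : ι → ℝ) (i : ι) : ℝ :=
  Real.exp (-s i) / ∑ j, Real.exp (-s j)

section Gibbs

variable {ι : Type*} [Fintype ι] [Nonempty ι] (s : ι → ℝ)

lemma gibbs_partition_pos : 0 < ∑ j, Real.exp (-s j) :=
  Finset.sum_pos (fun _ _ => Real.exp_pos _) Finset.univ_nonempty

lemma gibbs_nonneg (i : ι) : 0 ≤ gibbs s i :=
  div_nonneg (Real.exp_pos _).le (gibbs_partition_pos s).le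

lemma sum_gibbs : ∑ i, gibbs s i = 1 := by
  unfold gibbs
  rw [← Finset.sum_div, div_self (gibbs_partition_pos s).ne']

/-- If energy differences change by at most `ε`, Gibbs probabilities change by a factor of at
most `exp ε`. -/
lemma gibbs_le_exp_mul_gibbs {s s' : ι → ℝ} {ε : ℝ}
    (h : ∀ i j, (s' i - s i) + (s j - s' j) ≤ ε) (i : ι) :
    gibbs s i ≤ Real.exp ε * gibbs s' i := by
  unfold gibbs
  rw [← mul_div_assoc, div_le_div_iff₀ (gibbs_partition_pos s) (gibbs_partition_pos s'),
    Finset.mul_sum, Finset.mul_sum]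
  refine Finset.sum_le_sum fun j _ => ?_
  rw [← Real.exp_add, ← Real.exp_add, ← Real.exp_add, Real.exp_le_exp]
  linarith [h i j]

/-- The expected energy exceeds the energy of any fixed state by at most the log-cardinality. -/
lemma sum_gibbs_mul_le (i₀ : ι) :
    ∑ i, gibbs s i * s i ≤ s i₀ + Real.log (Fintype.card ι) := by
  have hN : (0 : ℝ) < Fintype.card ι := by exact_mod_cast Fintype.card_pos
  have hZ := gibbs_partition_pos s
  have key : ∀ i, gibbs s i * s i ≤ gibbs s i * (s i₀ + Real.log (Fintype.card ι) - 1) +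
      Real.exp (-s i₀) / (∑ j, Real.exp (-s j)) / Fintype.card ι := by
    intro i
    have h1 := Real.add_one_le_exp (s i - s i₀ - Real.log (Fintype.card ι))
    have h2 : gibbs s i * Real.exp (s i - s i₀ - Real.log (Fintype.card ι)) =
        Real.exp (-s i₀) / (∑ j, Real.exp (-s j)) / Fintype.card ι := by
      unfold gibbs
      rw [Real.exp_sub, Real.exp_log hN, Real.exp_sub, Real.exp_neg, Real.exp_neg (s i₀)]
      field_simp
    have h3 := mul_le_mul_of_nonneg_left h1 (gibbs_nonneg s i)
    rw [h2] at h3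
    linarith
  have hle : Real.exp (-s i₀) / (∑ j, Real.exp (-s j)) ≤ 1 := by
    rw [div_le_one hZ]
    exact Finset.single_le_sum (f := fun j => Real.exp (-s j))
      (fun _ _ => (Real.exp_pos _).le) (Finset.mem_univ i₀)
  calc ∑ i, gibbs s i * s i ≤ ∑ i, (gibbs s i * (s i₀ + Real.log (Fintype.card ι) - 1) +
      Real.exp (-s i₀) / (∑ j, Real.exp (-s j)) / Fintype.card ι) :=
        Finset.sum_le_sum fun i _ => key i
    _ = (s i₀ + Real.log (Fintype.card ι) - 1) +
        Real.exp (-s i₀) / (∑ j, Real.exp (-s j)) := by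
      rw [Finset.sum_add_distrib, ← Finset.sum_mul, sum_gibbs, Finset.sum_const,
        Finset.card_univ, nsmul_eq_mul]
      field_simp
    _ ≤ _ := by linarith

/-- The law of `F i` when `i` has the Gibbs distribution with energies `s`. -/
def gibbsMeasure {Ω : Type*} [MeasurableSpace Ω] (F : ι → Ω) (s : ι → ℝ) : Measure Ω :=
  ∑ i, ENNReal.ofReal (gibbs s i) • Measure.dirac (F i)

variable {Ω : Type*} [MeasurableSpace Ω] (F : ι → Ω)

lemma gibbsMeasure_apply_eq_one {S : Set Ω} (hS : ∀ i, F i ∈ S) :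
    gibbsMeasure F s S = 1 := by
  simp only [gibbsMeasure, Measure.finsetSum_apply, Measure.smul_apply, smul_eq_mul,
    Measure.dirac_apply_of_mem (hS _), mul_one]
  rw [← ENNReal.ofReal_sum_of_nonneg fun i _ => gibbs_nonneg s i, sum_gibbs, ENNReal.ofReal_one]

lemma gibbsMeasure_le_exp_mul {s s' : ι → ℝ} {ε : ℝ}
    (h : ∀ i j, (s' i - s i) + (s j - s' j) ≤ ε) (S : Set Ω) :
    gibbsMeasure F s S ≤ ENNReal.ofReal (Real.exp ε) * gibbsMeasure F s' S := by
  simp only [gibbsMeasure, Measure.finsetSum_apply, Measure.smul_apply, smul_eq_mul,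
    Finset.mul_sum, ← mul_assoc]
  gcongr with i
  rw [← ENNReal.ofReal_mul (Real.exp_pos ε).le]
  exact ENNReal.ofReal_le_ofReal (gibbs_le_exp_mul_gibbs h i)

lemma integral_gibbsMeasure [MeasurableSingletonClass Ω] (φ : Ω → ℝ) :
    ∫ ω, φ ω ∂(gibbsMeasure F s) = ∑ i, gibbs s i * φ (F i) := by
  unfold gibbsMeasure
  rw [integral_finsetSum_measure]
  · refine Finset.sum_congr rfl fun i _ => ?_
    rw [integral_smul_measure, integral_dirac, ENNReal.toReal_ofReal (gibbs_nonneg s i),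
      smul_eq_mul]
  · intro i _
    exact (integrable_dirac enorm_lt_top).smul_measure ENNReal.ofReal_ne_top

end Gibbs

/-- The step function on `Fin m` that increases by `1 / k` at each of `k` thresholds. -/
def stepFun {k m : ℕ} (t : Fin k → Fin (m + 1)) (x : Fin m) : ℝ :=
  ((Finset.univ.filter fun j => (t j : ℕ) ≤ x).card : ℝ) / k

lemma isMonotone01_stepFun {k m : ℕ} (t : Fin k → Fin (m + 1)) : IsMonotone01 (stepFun t) := by
  refine ⟨fun x y hxy => ?_, fun x => ⟨by unfold stepFun; positivity, ?_⟩⟩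
  · unfold stepFun
    gcongr
    exact hxy
  · refine div_le_one_of_le₀ ?_ k.cast_nonneg
    exact_mod_cast (Finset.card_le_univ _).trans (Fintype.card_fin k).le

lemma exists_threshold {m : ℕ} {P : Fin m → Prop} (hP : ∀ x y, x ≤ y → P x → P y) :
    ∃ s : Fin (m + 1), ∀ x : Fin m, (s : ℕ) ≤ x ↔ P x := by
  classical
  have hm : ∃ s : ℕ, ∀ x : Fin m, s ≤ x → P x := ⟨m, fun x hx => absurd x.2 hx.not_gt⟩
  refine ⟨⟨Nat.find hm, Nat.lt_succ_of_le (Nat.find_min' hm fun x hx => absurd x.2 hx.not_gt)⟩,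
    fun x => ⟨Nat.find_spec hm x, fun hx => ?_⟩⟩
  exact Nat.find_min' hm fun y hxy => hP x y hxy hx

/-- Every monotone `[0,1]`-valued function is `1 / k`-close to a step function. -/
lemma exists_stepFun_near {k m : ℕ} (hk : 0 < k) {g : Fin m → ℝ} (hg : IsMonotone01 g) :
    ∃ t : Fin k → Fin (m + 1), ∀ x, |stepFun t x - g x| ≤ 1 / k := by
  have hk' : (0 : ℝ) < k := by exact_mod_cast hk
  have hthr : ∀ j : Fin k, ∃ s : Fin (m + 1), ∀ x : Fin m,
      (s : ℕ) ≤ x ↔ (j : ℕ) < ⌊(k : ℝ) * g x⌋₊ := fun j => exists_threshold fun x y hxy h =>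
    h.trans_le (Nat.floor_mono (mul_le_mul_of_nonneg_left (hg.1 hxy) hk'.le))
  choose t ht using hthr
  refine ⟨t, fun x => ?_⟩
  have hF : ⌊(k : ℝ) * g x⌋₊ ≤ k :=
    Nat.floor_le_of_le (mul_le_of_le_one_right hk'.le (hg.2 x).2)
  have hcard : (Finset.univ.filter fun j => (t j : ℕ) ≤ x).card = ⌊(k : ℝ) * g x⌋₊ := by
    simp only [ht, Fin.card_filter_val_lt]
    exact min_eq_right hF
  have h1 := Nat.floor_le (mul_nonneg hk'.le (hg.2 x).1)
  have h2 := Nat.lt_floor_add_one ((k : ℝ) * g x)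
  have : stepFun t x - g x = ((⌊(k : ℝ) * g x⌋₊ : ℝ) - k * g x) / k := by
    unfold stepFun
    rw [hcard]
    field_simp
  rw [this, abs_div, abs_of_pos hk']
  gcongr
  rw [abs_le]
  constructor <;> linarith

section Risk

variable {X : Type*} {ℓ : ℝ → ℝ → ℝ} {L : ℝ} {n : ℕ}

lemma IsLipschitzLoss.nonneg (hℓ : IsLipschitzLoss ℓ L) : 0 ≤ L := by
  have := (abs_nonneg _).trans (hℓ.2 1 0 0 (by simp) (by simp) (by simp))
  simpa using this

lemma IsLipschitzLoss.sub_le (hℓ : IsLipschitzLoss ℓ L) {y y' z : ℝ} (hy : y ∈ Set.Icc (0 : ℝ) 1)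
    (hy' : y' ∈ Set.Icc (0 : ℝ) 1) (hz : z ∈ Set.Icc (0 : ℝ) 1) : ℓ y z - ℓ y' z ≤ L := by
  refine (le_abs_self _).trans ((hℓ.2 y y' z hy hy' hz).trans ?_)
  refine mul_le_of_le_one_right hℓ.nonneg (abs_le.2 ⟨?_, ?_⟩) <;>
    linarith [hy.1, hy.2, hy'.1, hy'.2]

lemma empRisk_le_add (hℓ : IsLipschitzLoss ℓ L) (hn : 1 ≤ n) {D : Fin n → X × ℝ}
    (hD : IsDataset D) {f g : X → ℝ} (hf : ∀ x, f x ∈ Set.Icc (0 : ℝ) 1)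
    (hg : ∀ x, g x ∈ Set.Icc (0 : ℝ) 1) {c : ℝ} (hc : ∀ x, |f x - g x| ≤ c) :
    empRisk ℓ f D ≤ empRisk ℓ g D + L * c := by
  have hn' : (0 : ℝ) < n := by exact_mod_cast hn
  have hsum : ∑ i, ℓ (f (D i).1) (D i).2 ≤ ∑ i, (ℓ (g (D i).1) (D i).2 + L * c) := by
    refine Finset.sum_le_sum fun i _ => ?_
    have h1 := (le_abs_self _).trans (hℓ.2 _ _ _ (hf (D i).1) (hg (D i).1) (hD i))
    have h2 := mul_le_mul_of_nonneg_left (hc (D i).1) hℓ.nonneg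
    linarith
  rw [Finset.sum_add_distrib, Finset.sum_const, Finset.card_univ, Fintype.card_fin,
    nsmul_eq_mul] at hsum
  unfold empRisk
  calc 1 / (n : ℝ) * ∑ i, ℓ (f (D i).1) (D i).2
      ≤ 1 / (n : ℝ) * (∑ i, ℓ (g (D i).1) (D i).2 + n * (L * c)) := by gcongr
    _ = _ := by field_simp

/-- Risk differences between two fixed functions change by at most `2 * L / n` between
neighboring datasets. -/
lemma empRisk_sensitivity (hℓ : IsLipschitzLoss ℓ L) {D D' : Fin n → X × ℝ}
    (hDD' : NeighborDS D D') {f g : X → ℝ} (hf : ∀ x, f x ∈ Set.Icc (0 : ℝ) 1)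
    (hg : ∀ x, g x ∈ Set.Icc (0 : ℝ) 1) :
    (empRisk ℓ f D' - empRisk ℓ f D) + (empRisk ℓ g D - empRisk ℓ g D') ≤ 2 * L / n := by
  obtain ⟨hD, hD', i, hi⟩ := hDD'
  have heq : (empRisk ℓ f D' - empRisk ℓ f D) + (empRisk ℓ g D - empRisk ℓ g D') =
      1 / (n : ℝ) * ∑ j, ((ℓ (f (D' j).1) (D' j).2 - ℓ (g (D' j).1) (D' j).2) +
        (ℓ (g (D j).1) (D j).2 - ℓ (f (D j).1) (D j).2)) := by
    simp only [empRisk, Finset.sum_add_distrib, Finset.sum_sub_distrib]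
    ring
  rw [heq, Finset.sum_eq_single i (fun j _ hj => by rw [hi j hj]; ring) (by simp),
    one_div_mul_eq_div]
  gcongr
  linarith [hℓ.sub_le (hf (D' i).1) (hg (D' i).1) (hD' i),
    hℓ.sub_le (hg (D i).1) (hf (D i).1) (hD i)]

end Risk

/-- With inverse temperature `ε * n / (2 * L)`, the expected risk of a Gibbs-distributed member of
a finite family is at most the best one in it plus `2 * L * log N / (ε * n)`. -/
lemma sum_gibbs_mul_empRisk_le {ι X : Type*} [Fintype ι] [Nonempty ι] {ℓ : ℝ → ℝ → ℝ} {L ε : ℝ}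
    {n : ℕ} (hL : 0 < L) (hε : 0 < ε) (hn : 1 ≤ n) (F : ι → X → ℝ) (D : Fin n → X × ℝ) (i₀ : ι) :
    ∑ i, gibbs (fun i => ε * n / (2 * L) * empRisk ℓ (F i) D) i * empRisk ℓ (F i) D ≤
      empRisk ℓ (F i₀) D + 2 * L * Real.log (Fintype.card ι) / (ε * n) := by
  have hn' : (0 : ℝ) < n := by exact_mod_cast hn
  have hη : 0 < ε * n / (2 * L) := by positivity
  have h := sum_gibbs_mul_le (fun i => ε * n / (2 * L) * empRisk ℓ (F i) D) i₀
  simp only [mul_left_comm _ (ε * n / (2 * L)), ← Finset.mul_sum] at h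
  refine le_of_mul_le_mul_left (h.trans_eq ?_) hη
  field_simp

lemma discretization_tradeoff {a : ℝ} (ha : 0 < a) (ha1 : a ≤ 1) :
    1 / (⌈1 / √a⌉₊ : ℝ) + 4 * (⌈1 / √a⌉₊ : ℝ) * a ≤ 9 * √a := by
  have hr : 0 < √a := Real.sqrt_pos.2 ha
  have hr1 : √a ≤ 1 := Real.sqrt_le_one.2 ha1
  have hsq : √a * √a = a := Real.mul_self_sqrt ha.le
  have h1 : 1 / √a ≤ (⌈1 / √a⌉₊ : ℝ) := Nat.le_ceil _
  have h2 : (⌈1 / √a⌉₊ : ℝ) < 1 / √a + 1 := Nat.ceil_lt_add_one (by positivity)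
  have hk : 1 / (⌈1 / √a⌉₊ : ℝ) ≤ √a := by
    simpa using one_div_le_one_div_of_le (by positivity) h1
  have h3 : (⌈1 / √a⌉₊ : ℝ) * a ≤ (1 / √a + 1) * a := by gcongr
  have h4 : (1 / √a + 1) * a = √a + a := by
    nth_rw 2 [← hsq]
    nth_rw 5 [← hsq]
    field_simp
  nlinarith

/-- **Baseline exponential mechanism for totally ordered sets.** There is a universal
constant `C > 0` such that for `X = {1,…,m}` (here `Fin m`), any `L`-Lipschitz loss `ℓ`,
any `ε > 0` and `n ≥ 1` with `m ≥ max{n,2}`, there is an `ε`-DP isotonic-regression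
mechanism with expected excess empirical risk at most `C · L · sqrt(log m / (εn))`. -/
theorem dp_isotonic_regression_total_order_baseline :
    ∃ C : ℝ, 0 < C ∧
      ∀ m n : ℕ,
        ∀ (ℓ : ℝ → ℝ → ℝ) (L : ℝ), IsLipschitzLoss ℓ L →
        ∀ ε : ℝ, 0 < ε → 1 ≤ n → max n 2 ≤ m →
        ∃ M : (Fin n → Fin m × ℝ) → Measure (Fin m → ℝ),
          IsIsoRegAlg M ∧
          IsDP NeighborDS M ε 0 ∧
          ∀ D : Fin n → Fin m × ℝ, IsDataset D →
            (∫ f, empRisk ℓ f D ∂(M D)) - optRisk ℓ D ≤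
              C * L * Real.sqrt (Real.log m / (ε * n)) := by
  refine ⟨9, by norm_num, fun m n ℓ L hℓ ε hε hn hm => ?_⟩
  have hn' : (0 : ℝ) < n := by exact_mod_cast hn
  have hm2 : 2 ≤ m := (le_max_right n 2).trans hm
  have hm' : (2 : ℝ) ≤ m := by exact_mod_cast hm2
  have hlog : 0 < Real.log m := Real.log_pos (by linarith)
  set a : ℝ := Real.log m / (ε * n) with ha_def
  have ha : 0 < a := by positivity
  set k : ℕ := ⌈1 / √a⌉₊ with hk_def
  have hk : 0 < k := Nat.ceil_pos.2 (by positivity)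
  let F : (Fin k → Fin (m + 1)) → Fin m → ℝ := stepFun
  have hF : ∀ t, IsMonotone01 (F t) := isMonotone01_stepFun
  refine ⟨fun D => gibbsMeasure F fun t => ε * n / (2 * L) * empRisk ℓ (F t) D, ?_, ?_, ?_⟩
  · exact fun D _ => ⟨⟨gibbsMeasure_apply_eq_one _ F fun _ => Set.mem_univ _⟩,
      gibbsMeasure_apply_eq_one _ F hF⟩
  · intro D D' hDD' S _
    rw [ENNReal.ofReal_zero, add_zero]
    refine gibbsMeasure_le_exp_mul F (fun t u => ?_) S
    have h := empRisk_sensitivity hℓ hDD' (hF t).2 (hF u).2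
    have hη : 0 ≤ ε * n / (2 * L) := by have := hℓ.nonneg; positivity
    rw [← mul_sub, ← mul_sub, ← mul_add]
    refine (mul_le_mul_of_nonneg_left h hη).trans ?_
    rcases hℓ.nonneg.eq_or_lt with hL | hL
    · simp [← hL, hε.le]
    · exact le_of_eq (by field_simp)
  · intro D hD
    have hL := hℓ.nonneg
    rw [integral_gibbsMeasure, sub_le_comm]
    have : Nonempty {g : Fin m → ℝ // IsMonotone01 g} :=
      ⟨⟨fun _ => 0, monotone_const, by simp⟩⟩
    refine le_ciInf fun ⟨g, hg⟩ => ?_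
    rw [sub_le_iff_le_add]
    by_cases hcase : 0 < L ∧ a ≤ 1
    · obtain ⟨hLpos, ha1⟩ := hcase
      obtain ⟨t₀, ht₀⟩ := exists_stepFun_near hk hg
      have h1 := sum_gibbs_mul_empRisk_le (ℓ := ℓ) hLpos hε hn F D t₀
      have h2 := empRisk_le_add hℓ hn hD (hF t₀).2 hg.2 ht₀
      have hcard : Real.log (Fintype.card (Fin k → Fin (m + 1))) ≤ k * (2 * Real.log m) := by
        rw [Fintype.card_fun, Fintype.card_fin, Fintype.card_fin, Nat.cast_pow, Real.log_pow]
        gcongr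
        have : (2 : ℝ) * Real.log m = Real.log ((m : ℝ) ^ 2) := by
          rw [Real.log_pow]; norm_num
        rw [this]
        refine Real.log_le_log (by positivity) ?_
        push_cast
        nlinarith
      have h3 : 2 * L * Real.log (Fintype.card (Fin k → Fin (m + 1))) / (ε * n) ≤
          2 * L * (k * (2 * Real.log m)) / (ε * n) := by gcongr
      have h4 : 2 * L * (k * (2 * Real.log m)) / (ε * n) = L * (4 * k * a) := by
        rw [ha_def]; ring
      have h5 := mul_le_mul_of_nonneg_left (discretization_tradeoff ha ha1) hL
      linarith
    · have h1 : ∀ t, empRisk ℓ (F t) D ≤ empRisk ℓ g D + L * 1 := fun t =>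
        empRisk_le_add hℓ hn hD (hF t).2 hg.2 fun x =>
          abs_le.2 ⟨by linarith [((hF t).2 x).1, (hg.2 x).2],
            by linarith [((hF t).2 x).2, (hg.2 x).1]⟩
      have h2 : L ≤ 9 * L * √a := by
        rcases hL.eq_or_lt with hL0 | hLpos
        · simp [← hL0]
        · have : 1 ≤ √a := Real.one_le_sqrt.2 (le_of_not_ge fun h => hcase ⟨hLpos, h⟩)
          nlinarith
      calc _ ≤ ∑ t, gibbs (fun t => ε * n / (2 * L) * empRisk ℓ (F t) D) t *
            (empRisk ℓ g D + L * 1) :=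
            Finset.sum_le_sum fun t _ => mul_le_mul_of_nonneg_left (h1 t) (gibbs_nonneg _ t)
        _ = empRisk ℓ g D + L := by rw [← Finset.sum_mul, sum_gibbs, one_mul, mul_one]
        _ ≤ _ := by linarith
end
end
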